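/- arXiv:2505.11279 — 9 statements merged into one kernel-verified Lean document; each statement's English description precedes it below -/
import Mathlib

section
/- Let N ≥ 1, let U ⊆ ℝ^N be open, and let f : U × ℝ^N → ℝ satisfy: f is lower semicontinuous jointly in (x,ξ); for each x ∈ U the map ξ ↦ f(x,ξ) is convex; and α·|ξ| ≤ f(x,ξ) ≤ β·(|ξ|+1) for all (x,ξ) with constants 0 < α ≤ β. Define f∞(x,ξ) := lim_{s→∞} f(x,s·ξ)/s and the perspective f̃(x,t,ξ) := t·f(x,ξ/t) for t > 0, f̃(x,0,ξ) := f∞(x,ξ). Then f̃ is lower semicontinuous on U × [0,∞) × ℝ^N (with [0,∞) carrying the subspace topology of ℝ); in particular, (x,ξ) ↦ f∞(x,ξ) is lower semicontinuous on U × ℝ^N. -/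
open Filter

/-- The perspective (homogenized) function of an `x`-dependent integrand
`f : U × ℝ^N → ℝ` with recession function `finf`, as a function of
`(x, t, ξ) ∈ U × [0,∞) × ℝ^N`. -/
noncomputable def persx {N : ℕ}
    (f : EuclideanSpace ℝ (Fin N) × EuclideanSpace ℝ (Fin N) → ℝ)
    (finf : EuclideanSpace ℝ (Fin N) → EuclideanSpace ℝ (Fin N) → ℝ) :
    EuclideanSpace ℝ (Fin N) × ℝ × EuclideanSpace ℝ (Fin N) → ℝ :=
  fun q => if 0 < q.2.1 then q.2.1 * f (q.1, q.2.1⁻¹ • q.2.2) else finf q.1 q.2.2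

/-- For convex `g` with `0 ≤ g 0 ≤ β`, the perspective `t * g (t⁻¹ • ξ)` with `t ≤ 1 / s` is bounded
below by the shifted quotient `(g (s • ξ) - β) / s`. -/
theorem sub_div_le_mul_of_convexOn {E : Type*} [NormedAddCommGroup E] [NormedSpace ℝ E]
    {g : E → ℝ} {β s t : ℝ} (hg : ConvexOn ℝ Set.univ g) (h0 : 0 ≤ g 0) (hβ : g 0 ≤ β)
    (hs : 0 < s) (ht : 0 < t) (hst : s * t ≤ 1) (ξ : E) :
    (g (s • ξ) - β) / s ≤ t * g (t⁻¹ • ξ) := by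
  have hc := hg.2 (Set.mem_univ (t⁻¹ • ξ)) (Set.mem_univ (0 : E)) (by positivity : 0 ≤ s * t)
    (sub_nonneg.2 hst) (by ring)
  have he : (s * t) • t⁻¹ • ξ + (1 - s * t) • (0 : E) = s • ξ := by
    rw [smul_zero, add_zero, smul_smul, mul_assoc, mul_inv_cancel₀ ht.ne', mul_one]
  rw [he, smul_eq_mul, smul_eq_mul] at hc
  rw [div_le_iff₀ hs]
  nlinarith [mul_nonneg (mul_pos hs ht).le h0]

/-- The recession limit is bounded below by the same shifted quotients. -/
theorem sub_div_le_of_tendsto_recession {E : Type*} [NormedAddCommGroup E] [NormedSpace ℝ E]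
    {g : E → ℝ} {β s l : ℝ} (hg : ConvexOn ℝ Set.univ g) (h0 : 0 ≤ g 0) (hβ : g 0 ≤ β)
    (hs : 0 < s) {ξ : E} (hl : Tendsto (fun r : ℝ => g (r • ξ) / r) atTop (nhds l)) :
    (g (s • ξ) - β) / s ≤ l := by
  refine ge_of_tendsto hl ?_
  filter_upwards [eventually_ge_atTop s] with r hr
  have hr0 : 0 < r := hs.trans_le hr
  have h := sub_div_le_mul_of_convexOn hg h0 hβ hs (inv_pos.2 hr0)
    (by rw [← div_eq_mul_inv]; exact (div_le_one hr0).2 hr) ξ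
  rwa [inv_inv, inv_mul_eq_div] at h

/-- If `f : U × ℝ^N → ℝ` is jointly lower semicontinuous,
convex in `ξ`, and of linear growth, then the perspective function `f̃` is
lower semicontinuous on `U × [0,∞) × ℝ^N`; in particular the recession function
`f∞` is lower semicontinuous on `U × ℝ^N`. -/
theorem perspective_lowerSemicontinuous (N : ℕ) (hN : 1 ≤ N)
    (U : Set (EuclideanSpace ℝ (Fin N))) (hU : IsOpen U)
    (f : EuclideanSpace ℝ (Fin N) × EuclideanSpace ℝ (Fin N) → ℝ)
    (finf : EuclideanSpace ℝ (Fin N) → EuclideanSpace ℝ (Fin N) → ℝ)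
    (α β : ℝ) (hα : 0 < α) (hαβ : α ≤ β)
    (hlsc : LowerSemicontinuousOn f (U ×ˢ (Set.univ : Set (EuclideanSpace ℝ (Fin N)))))
    (hconv : ∀ x ∈ U, ConvexOn ℝ Set.univ (fun ξ => f (x, ξ)))
    (hgrowth : ∀ x ∈ U, ∀ ξ : EuclideanSpace ℝ (Fin N),
      α * ‖ξ‖ ≤ f (x, ξ) ∧ f (x, ξ) ≤ β * (‖ξ‖ + 1))
    (hfinf : ∀ x ∈ U, ∀ ξ : EuclideanSpace ℝ (Fin N),
      Tendsto (fun s : ℝ => f (x, s • ξ) / s) atTop (nhds (finf x ξ))) :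
    LowerSemicontinuousOn (persx f finf)
      (U ×ˢ (Set.Ici (0 : ℝ) ×ˢ (Set.univ : Set (EuclideanSpace ℝ (Fin N))))) ∧
    LowerSemicontinuousOn
      (fun q : EuclideanSpace ℝ (Fin N) × EuclideanSpace ℝ (Fin N) => finf q.1 q.2)
      (U ×ˢ (Set.univ : Set (EuclideanSpace ℝ (Fin N)))) := by
  have h0 : ∀ x ∈ U, 0 ≤ f (x, 0) ∧ f (x, 0) ≤ β := fun x hx => by
    simpa using hgrowth x hx 0
  have hlsc' : LowerSemicontinuousOn (persx f finf)
      (U ×ˢ (Set.Ici (0 : ℝ) ×ˢ (Set.univ : Set (EuclideanSpace ℝ (Fin N))))) := by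
    rintro ⟨x, t, ξ⟩ ⟨hx, ht, -⟩ y hy
    simp only [Set.mem_Ici] at hx ht
    have hfst : Tendsto (fun q : EuclideanSpace ℝ (Fin N) × ℝ × EuclideanSpace ℝ (Fin N) => q.2.1)
        (nhdsWithin (x, t, ξ) (U ×ˢ (Set.Ici (0 : ℝ) ×ˢ Set.univ))) (nhds t) :=
      (continuous_fst.comp continuous_snd).continuousAt.tendsto.mono_left nhdsWithin_le_nhds
    rcases ht.eq_or_lt with rfl | ht
    · simp only [persx, lt_irrefl, if_false] at hy
      obtain ⟨s, hs, hys⟩ : ∃ s : ℝ, 0 < s ∧ y < (f (x, s • ξ) - β) / s := by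
        have hlim : Tendsto (fun s : ℝ => (f (x, s • ξ) - β) / s) atTop (nhds (finf x ξ)) := by
          simpa [sub_div] using
            (hfinf x hx ξ).sub (tendsto_const_nhds.div_atTop tendsto_id : Tendsto
              (fun s : ℝ => β / s) atTop (nhds 0))
        exact ((eventually_gt_atTop 0).and (hlim.eventually (lt_mem_nhds hy))).exists
      have hφ : Tendsto (fun q : EuclideanSpace ℝ (Fin N) × ℝ × EuclideanSpace ℝ (Fin N) =>
          (q.1, s • q.2.2)) (nhdsWithin (x, 0, ξ) (U ×ˢ (Set.Ici (0 : ℝ) ×ˢ Set.univ)))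
          (nhdsWithin (x, s • ξ) (U ×ˢ Set.univ)) := by
        refine (ContinuousWithinAt.tendsto_nhdsWithin (by fun_prop) ?_)
        exact fun q hq => ⟨hq.1, Set.mem_univ _⟩
      have hlt : y * s + β < f (x, s • ξ) := by
        rw [lt_div_iff₀ hs] at hys; linarith
      filter_upwards [hφ.eventually (hlsc _ ⟨hx, Set.mem_univ _⟩ _ hlt), self_mem_nhdsWithin,
        hfst.eventually (gt_mem_nhds (inv_pos.2 hs))] with ⟨x', t', ξ'⟩ hq hmem ht'
      obtain ⟨hx', ht0, -⟩ := hmem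
      simp only [Set.mem_Ici] at hx' ht0 ht' hq
      have hq' : y < (f (x', s • ξ') - β) / s := by rw [lt_div_iff₀ hs]; linarith
      refine hq'.trans_le ?_
      simp only [persx]
      split_ifs with hpos
      · refine sub_div_le_mul_of_convexOn (hconv x' hx') (h0 x' hx').1 (h0 x' hx').2 hs hpos ?_ ξ'
        rw [← mul_inv_cancel₀ hs.ne']
        gcongr
      · exact sub_div_le_of_tendsto_recession (hconv x' hx') (h0 x' hx').1 (h0 x' hx').2 hs
          (hfinf x' hx' ξ')
    · simp only [persx, ht, if_true] at hy
      have hy' : y / t < f (x, t⁻¹ • ξ) := by rwa [div_lt_iff₀' ht]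
      obtain ⟨c, hyc, hc⟩ := exists_between hy'
      have hφ : Tendsto (fun q : EuclideanSpace ℝ (Fin N) × ℝ × EuclideanSpace ℝ (Fin N) =>
          (q.1, q.2.1⁻¹ • q.2.2)) (nhdsWithin (x, t, ξ) (U ×ˢ (Set.Ici (0 : ℝ) ×ˢ Set.univ)))
          (nhdsWithin (x, t⁻¹ • ξ) (U ×ˢ Set.univ)) := by
        refine ContinuousWithinAt.tendsto_nhdsWithin (ContinuousAt.continuousWithinAt ?_) ?_
        · have : ((x, t, ξ) : EuclideanSpace ℝ (Fin N) × ℝ × EuclideanSpace ℝ (Fin N)).2.1 ≠ 0 :=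
            ht.ne'
          fun_prop (disch := assumption)
        · exact fun q hq => ⟨hq.1, Set.mem_univ _⟩
      have hyt : Tendsto (fun q : EuclideanSpace ℝ (Fin N) × ℝ × EuclideanSpace ℝ (Fin N) =>
          y / q.2.1) (nhdsWithin (x, t, ξ) (U ×ˢ (Set.Ici (0 : ℝ) ×ˢ Set.univ)))
          (nhds (y / t)) := tendsto_const_nhds.div hfst ht.ne'
      filter_upwards [hφ.eventually (hlsc _ ⟨hx, Set.mem_univ _⟩ _ hc),
        hfst.eventually (lt_mem_nhds ht), hyt.eventually (gt_mem_nhds hyc)] with q hq hq0 hqy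
      simp only [persx, hq0, if_true]
      exact (div_lt_iff₀' hq0).1 (hqy.trans hq)
  refine ⟨hlsc', ?_⟩
  have hcomp := hlsc'.comp
    (g := fun q : EuclideanSpace ℝ (Fin N) × EuclideanSpace ℝ (Fin N) => (q.1, (0 : ℝ), q.2))
    (t := U ×ˢ Set.univ) (by fun_prop)
    (fun q hq => ⟨hq.1, Set.mem_Ici.2 le_rfl, Set.mem_univ _⟩)
  simpa [persx, Function.comp_def] using hcomp
end

section
/- Let N ≥ 1, let U ⊆ ℝ^N be open, and let f : U × ℝ^N → ℝ satisfy: for each x ∈ U the map ξ ↦ f(x,ξ) is convex; α·|ξ| ≤ f(x,ξ) ≤ β·(|ξ|+1) for all (x,ξ) with constants 0 < α ≤ β; and both f and its recession function f∞ are continuous jointly in (x,ξ) on U × ℝ^N. Then the perspective function f̃ is continuous on U × [0,∞) × ℝ^N (with [0,∞) carrying the subspace topology of ℝ). -/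
open Filter

/-- Difference quotients at the origin of a convex function are monotone along rays. -/
theorem ConvexOn.ray_slope_mono {E : Type*} [AddCommGroup E] [Module ℝ E] {g : E → ℝ}
    (hg : ConvexOn ℝ Set.univ g) (ξ : E) {r s : ℝ} (hr : 0 < r) (hrs : r ≤ s) :
    (g (r • ξ) - g 0) / r ≤ (g (s • ξ) - g 0) / s := by
  have hs : 0 < s := hr.trans_le hrs
  have h := hg.2 (Set.mem_univ (0 : E)) (Set.mem_univ (s • ξ))
    (sub_nonneg.2 ((div_le_one hs).2 hrs)) (div_pos hr hs).le (by ring)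
  rw [smul_zero, zero_add, smul_smul, div_mul_cancel₀ _ hs.ne', smul_eq_mul, smul_eq_mul] at h
  rw [div_le_iff₀ hr]
  calc g (r • ξ) - g 0 ≤ r / s * (g (s • ξ) - g 0) := by linarith
    _ = (g (s • ξ) - g 0) / s * r := by ring

/-- Subtracting the value at the origin does not change the recession limit. -/
theorem tendsto_ray_slope {E : Type*} [AddCommGroup E] [Module ℝ E] {g : E → ℝ} {ξ : E} {L : ℝ}
    (h : Tendsto (fun s : ℝ => g (s • ξ) / s) atTop (nhds L)) :
    Tendsto (fun s : ℝ => (g (s • ξ) - g 0) / s) atTop (nhds L) := by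
  simpa [sub_div] using h.sub (tendsto_const_nhds (x := g 0).div_atTop tendsto_id)

/-- Difference quotients at the origin of a convex function are bounded by the recession limit. -/
theorem ConvexOn.ray_slope_le {E : Type*} [AddCommGroup E] [Module ℝ E] {g : E → ℝ}
    (hg : ConvexOn ℝ Set.univ g) {ξ : E} {L : ℝ}
    (h : Tendsto (fun s : ℝ => g (s • ξ) / s) atTop (nhds L)) {r : ℝ} (hr : 0 < r) :
    (g (r • ξ) - g 0) / r ≤ L :=
  ge_of_tendsto (tendsto_ray_slope h)
    ((eventually_ge_atTop r).mono fun _ hs => hg.ray_slope_mono ξ hr hs)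

/-- If `f : U × ℝ^N → ℝ` is convex in `ξ`, of linear growth,
and both `f` and its recession function `f∞` are jointly continuous, then the
perspective function `f̃` is continuous on `U × [0,∞) × ℝ^N`. -/
theorem perspective_continuous (N : ℕ) (hN : 1 ≤ N)
    (U : Set (EuclideanSpace ℝ (Fin N))) (hU : IsOpen U)
    (f : EuclideanSpace ℝ (Fin N) × EuclideanSpace ℝ (Fin N) → ℝ)
    (finf : EuclideanSpace ℝ (Fin N) → EuclideanSpace ℝ (Fin N) → ℝ)
    (α β : ℝ) (hα : 0 < α) (hαβ : α ≤ β)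
    (hconv : ∀ x ∈ U, ConvexOn ℝ Set.univ (fun ξ => f (x, ξ)))
    (hgrowth : ∀ x ∈ U, ∀ ξ : EuclideanSpace ℝ (Fin N),
      α * ‖ξ‖ ≤ f (x, ξ) ∧ f (x, ξ) ≤ β * (‖ξ‖ + 1))
    (hfinf : ∀ x ∈ U, ∀ ξ : EuclideanSpace ℝ (Fin N),
      Tendsto (fun s : ℝ => f (x, s • ξ) / s) atTop (nhds (finf x ξ)))
    (hfcont : ContinuousOn f (U ×ˢ (Set.univ : Set (EuclideanSpace ℝ (Fin N)))))
    (hfinfcont : ContinuousOn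
      (fun q : EuclideanSpace ℝ (Fin N) × EuclideanSpace ℝ (Fin N) => finf q.1 q.2)
      (U ×ˢ (Set.univ : Set (EuclideanSpace ℝ (Fin N))))) :
    ContinuousOn (persx f finf)
      (U ×ˢ (Set.Ici (0 : ℝ) ×ˢ (Set.univ : Set (EuclideanSpace ℝ (Fin N))))) := by
  rintro ⟨x₀, t₀, ξ₀⟩ ⟨hx₀, ht₀, -⟩
  have hcomp {S : Set (EuclideanSpace ℝ (Fin N) × ℝ × EuclideanSpace ℝ (Fin N))}
      {k : EuclideanSpace ℝ (Fin N) × EuclideanSpace ℝ (Fin N) → ℝ}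
      {c : EuclideanSpace ℝ (Fin N) × ℝ × EuclideanSpace ℝ (Fin N) → EuclideanSpace ℝ (Fin N)}
      {q₀ : EuclideanSpace ℝ (Fin N) × ℝ × EuclideanSpace ℝ (Fin N)}
      (hk : ContinuousOn k (U ×ˢ Set.univ)) (hq₀ : q₀.1 ∈ U)
      (hc : ContinuousWithinAt c S q₀) :
      ContinuousWithinAt (fun q => k (q.1, c q)) S q₀ :=
    ContinuousAt.comp_continuousWithinAt (g := k)
      (f := fun q : EuclideanSpace ℝ (Fin N) × ℝ × EuclideanSpace ℝ (Fin N) => (q.1, c q))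
      (hk.continuousAt ((hU.prod isOpen_univ).mem_nhds ⟨hq₀, trivial⟩))
      (continuous_fst.continuousWithinAt.prodMk hc)
  rcases (Set.mem_Ici.1 ht₀).lt_or_eq with ht | rfl
  · have ht' : t₀ ≠ 0 := ht.ne'
    have hpos : ∀ᶠ q : EuclideanSpace ℝ (Fin N) × ℝ × EuclideanSpace ℝ (Fin N) in
        nhds (x₀, t₀, ξ₀), 0 < q.2.1 :=
      (isOpen_lt continuous_const (continuous_fst.comp continuous_snd)).mem_nhds ht
    have ht_cont : ContinuousAt
        (fun q : EuclideanSpace ℝ (Fin N) × ℝ × EuclideanSpace ℝ (Fin N) => q.2.1)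
        (x₀, t₀, ξ₀) := by fun_prop
    refine ContinuousWithinAt.congr_of_eventuallyEq
      (f := fun q : EuclideanSpace ℝ (Fin N) × ℝ × EuclideanSpace ℝ (Fin N) =>
        q.2.1 * f (q.1, q.2.1⁻¹ • q.2.2)) ?_ ?_ (if_pos ht)
    · exact ht_cont.continuousWithinAt.mul (hcomp hfcont hx₀
        ((ht_cont.inv₀ ht').smul (by fun_prop)).continuousWithinAt)
    · filter_upwards [nhdsWithin_le_nhds hpos] with q hq using if_pos hq
  · have hpers {x ξ : EuclideanSpace ℝ (Fin N)} {t : ℝ} (ht : 0 < t) :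
        persx f finf (x, t, ξ) = t * f (x, 0) + (f (x, t⁻¹ • ξ) - f (x, 0)) / t⁻¹ := by
      rw [persx, if_pos ht, div_inv_eq_mul]
      ring
    have hpers_zero {x ξ : EuclideanSpace ℝ (Fin N)} :
        persx f finf (x, 0, ξ) = finf x ξ := if_neg (lt_irrefl _)
    have hbase : ContinuousWithinAt
        (fun q : EuclideanSpace ℝ (Fin N) × ℝ × EuclideanSpace ℝ (Fin N) => q.2.1 * f (q.1, 0))
        (U ×ˢ (Set.Ici (0 : ℝ) ×ˢ Set.univ)) (x₀, 0, ξ₀) :=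
      ContinuousWithinAt.mul (by fun_prop) (hcomp hfcont hx₀ continuousWithinAt_const)
    rw [ContinuousWithinAt, hpers_zero, tendsto_order]
    refine ⟨fun a ha => ?_, fun a ha => ?_⟩
    · obtain ⟨S, hSa, hS⟩ := (((tendsto_ray_slope (g := fun ξ => f (x₀, ξ))
        (hfinf x₀ hx₀ ξ₀)).eventually_const_lt ha).and (eventually_gt_atTop 0)).exists
      have hlower : ContinuousWithinAt
          (fun q : EuclideanSpace ℝ (Fin N) × ℝ × EuclideanSpace ℝ (Fin N) =>
            q.2.1 * f (q.1, 0) + (f (q.1, S • q.2.2) - f (q.1, 0)) / S)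
          (U ×ˢ (Set.Ici (0 : ℝ) ×ˢ Set.univ)) (x₀, 0, ξ₀) :=
        hbase.add (((hcomp hfcont hx₀ (by fun_prop)).sub
          (hcomp hfcont hx₀ continuousWithinAt_const)).div_const S)
      have hsmall : ∀ᶠ q : EuclideanSpace ℝ (Fin N) × ℝ × EuclideanSpace ℝ (Fin N) in
          nhds (x₀, 0, ξ₀), q.2.1 < S⁻¹ :=
        (isOpen_lt (continuous_fst.comp continuous_snd) continuous_const).mem_nhds
          (inv_pos.2 hS)
      filter_upwards [hlower.tendsto.eventually_const_lt (by simpa using hSa),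
        nhdsWithin_le_nhds hsmall, self_mem_nhdsWithin]
      rintro ⟨x, t, ξ⟩ hq htS ⟨hx, ht, -⟩
      refine hq.trans_le ?_
      rcases (Set.mem_Ici.1 ht).lt_or_eq with ht | rfl
      · rw [hpers ht]
        gcongr 1
        exact (hconv x hx).ray_slope_mono ξ hS ((le_inv_comm₀ ht hS).1 htS.le)
      · rw [hpers_zero, zero_mul, zero_add]
        exact (hconv x hx).ray_slope_le (hfinf x hx ξ) hS
    · have hupper : ContinuousWithinAt
          (fun q : EuclideanSpace ℝ (Fin N) × ℝ × EuclideanSpace ℝ (Fin N) =>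
            q.2.1 * f (q.1, 0) + finf q.1 q.2.2)
          (U ×ˢ (Set.Ici (0 : ℝ) ×ˢ Set.univ)) (x₀, 0, ξ₀) :=
        hbase.add (hcomp hfinfcont hx₀ (by fun_prop))
      filter_upwards [hupper.tendsto.eventually_lt_const (by simpa using ha),
        self_mem_nhdsWithin]
      rintro ⟨x, t, ξ⟩ hq ⟨hx, ht, -⟩
      refine lt_of_le_of_lt ?_ hq
      rcases (Set.mem_Ici.1 ht).lt_or_eq with ht | rfl
      · rw [hpers ht]
        gcongr 1
        exact (hconv x hx).ray_slope_le (hfinf x hx ξ) (inv_pos.2 ht)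
      · rw [hpers_zero, zero_mul, zero_add]
end

section
/- Let N ≥ 1 and let p : ℝ^N → ℝ be continuous, positively 1-homogeneous, with p(ξ) > 0 for all ξ ≠ 0, and let p° be its polar. Suppose ξ* ∈ ℝ^N, ξ* ≠ 0, is a point where p° is differentiable with gradient g := ∇p°(ξ*). Then for every ξ ∈ ℝ^N with ξ ≠ 0, equality ⟨ξ*, ξ⟩ = p°(ξ*)·p(ξ) in the anisotropic Cauchy–Schwarz inequality holds if and only if ξ = p(ξ)·g, i.e. ξ/p(ξ) = ∇p°(ξ*). -/
open Filter
open scoped RealInnerProductSpace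

section Polar

variable {E : Type*} [NormedAddCommGroup E] [InnerProductSpace ℝ E] {p P : E → ℝ} {x g : E}

/-- A function bounding a linear functional from above has that functional as its derivative at
any point where the bound is attained. -/
theorem HasFDerivAt.eq_of_inner_le_of_eq {v : E} (hderiv : HasFDerivAt P (innerSL ℝ g) x)
    (hle : ∀ y, ⟪y, v⟫ ≤ P y) (heq : ⟪x, v⟫ = P x) : g = v := by
  have hmin : IsLocalMin (fun y => P y - innerSL ℝ v y) x := by
    refine Eventually.of_forall fun y => ?_
    have := hle y
    simp only [innerSL_apply_apply, real_inner_comm _ v, heq] at this ⊢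
    linarith
  have h := hmin.hasFDerivAt_eq_zero (hderiv.sub (innerSL ℝ v).hasFDerivAt)
  refine ext_inner_right ℝ fun y => sub_eq_zero.mp ?_
  simpa using DFunLike.congr_fun h y

/-- Euler's identity for positively subhomogeneous functions. -/
theorem HasFDerivAt.inner_eq_of_smul_le (hderiv : HasFDerivAt P (innerSL ℝ g) x)
    (hle : ∀ t : ℝ, 0 < t → P (t • x) ≤ t * P x) : ⟪g, x⟫ = P x := by
  have hmin : IsLocalMin (fun t : ℝ => t * P x - P (t • x)) 1 := by
    filter_upwards [lt_mem_nhds (zero_lt_one (α := ℝ))] with t ht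
    simpa using hle t ht
  have hline : HasDerivAt (fun t : ℝ => t • x) x 1 := by
    simpa using (hasDerivAt_id (1 : ℝ)).smul_const x
  have hcomp : HasDerivAt (fun t : ℝ => P (t • x)) (innerSL ℝ g x) 1 :=
    HasFDerivAt.comp_hasDerivAt (l := P) (1 : ℝ) (by simpa using hderiv) hline
  have h := hmin.hasDerivAt_eq_zero (((hasDerivAt_id (1 : ℝ)).mul_const (P x)).sub hcomp)
  simp only [innerSL_apply_apply, one_mul] at h
  linarith

/-- A polar function is positively subhomogeneous. -/
theorem polar_smul_le
    (hP : ∀ y : E, IsLUB {r : ℝ | ∃ ξ : E, ξ ≠ 0 ∧ r = ⟪y, ξ⟫ / p ξ} (P y))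
    (y : E) {t : ℝ} (ht : 0 < t) : P (t • y) ≤ t * P y := by
  refine (hP (t • y)).2 ?_
  rintro _ ⟨ξ, hξ, rfl⟩
  rw [real_inner_smul_left, mul_div_assoc]
  exact mul_le_mul_of_nonneg_left ((hP y).1 ⟨ξ, hξ, rfl⟩) ht.le

end Polar

/-- Let `p : ℝ^N → ℝ` be continuous, positively 1-homogeneous,
positive off the origin, with polar `P = p°`. If `p°` is differentiable at
`ξ* ≠ 0` with gradient `g`, then for `ξ ≠ 0`, equality
`⟪ξ*, ξ⟫ = p°(ξ*) p(ξ)` in the anisotropic Cauchy–Schwarz inequality holds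
iff `ξ = p(ξ) • g`, i.e. `ξ / p(ξ) = ∇p°(ξ*)`. -/
theorem polar_equality_characterization (N : ℕ) (hN : 1 ≤ N)
    (p : EuclideanSpace ℝ (Fin N) → ℝ)
    (hcont : Continuous p)
    (hhom : ∀ t : ℝ, 0 ≤ t → ∀ ξ : EuclideanSpace ℝ (Fin N), p (t • ξ) = t * p ξ)
    (hpos : ∀ ξ : EuclideanSpace ℝ (Fin N), ξ ≠ 0 → 0 < p ξ)
    (P : EuclideanSpace ℝ (Fin N) → ℝ)
    (hP : ∀ y : EuclideanSpace ℝ (Fin N),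
      IsLUB {r : ℝ | ∃ ξ : EuclideanSpace ℝ (Fin N), ξ ≠ 0 ∧ r = ⟪y, ξ⟫ / p ξ} (P y))
    (ξstar g : EuclideanSpace ℝ (Fin N)) (hξstar : ξstar ≠ 0)
    (hderiv : HasFDerivAt P (innerSL ℝ g) ξstar) :
    ∀ ξ : EuclideanSpace ℝ (Fin N), ξ ≠ 0 →
      (⟪ξstar, ξ⟫ = P ξstar * p ξ ↔ ξ = p ξ • g) := by
  intro ξ hξ
  have hpξ := hpos ξ hξ
  constructor
  · intro h
    have hg : g = (p ξ)⁻¹ • ξ := by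
      refine hderiv.eq_of_inner_le_of_eq (fun y => ?_) ?_
      · rw [real_inner_smul_right, ← div_eq_inv_mul]
        exact (hP y).1 ⟨ξ, hξ, rfl⟩
      · rw [real_inner_smul_right, h]
        field_simp
    rw [hg, smul_inv_smul₀ hpξ.ne']
  · intro h
    have hEuler := hderiv.inner_eq_of_smul_le fun t ht => polar_smul_le hP ξstar ht
    calc ⟪ξstar, ξ⟫ = ⟪ξstar, p ξ • g⟫ := by rw [← h]
      _ = P ξstar * p ξ := by
        rw [real_inner_smul_right, real_inner_comm, hEuler, mul_comm]
end

section
/- Let N ≥ 1 and let p : ℝ^N → ℝ be continuous, positively 1-homogeneous, with p(ξ) > 0 for all ξ ≠ 0, and let p° be its polar. Then for every point ξ* ∈ ℝ^N with ξ* ≠ 0 at which p° is differentiable with gradient ∇p°(ξ*), one has p(∇p°(ξ*)) = 1. -/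
open Filter
open scoped RealInnerProductSpace

/-- The supremum defining the polar of a gauge is attained at a vector of gauge one. -/
theorem exists_gauge_eq_one_and_inner_eq_polar {E : Type*} [NormedAddCommGroup E]
    [InnerProductSpace ℝ E] [FiniteDimensional ℝ E] {p : E → ℝ} (hcont : Continuous p)
    (hhom : ∀ t : ℝ, 0 ≤ t → ∀ ξ : E, p (t • ξ) = t * p ξ)
    (hpos : ∀ ξ : E, ξ ≠ 0 → 0 < p ξ) [Nontrivial E] {y : E} {r : ℝ}
    (hr : IsLUB {r : ℝ | ∃ ξ : E, ξ ≠ 0 ∧ r = ⟪y, ξ⟫ / p ξ} r) :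
    ∃ η : E, p η = 1 ∧ ⟪y, η⟫ = r := by
  have hne : ∀ ξ ∈ Metric.sphere (0 : E) 1, ξ ≠ 0 := fun ξ hξ =>
    ne_zero_of_mem_unit_sphere ⟨ξ, hξ⟩
  have hco : ContinuousOn (fun ξ : E => ⟪y, ξ⟫ / p ξ) (Metric.sphere 0 1) :=
    (continuous_const.inner continuous_id).continuousOn.div hcont.continuousOn
      fun ξ hξ => (hpos ξ (hne ξ hξ)).ne'
  obtain ⟨u, hu, hmax⟩ := (isCompact_sphere (0 : E) 1).exists_isMaxOn
    (NormedSpace.sphere_nonempty.mpr zero_le_one) hco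
  have hpu := hpos u (hne u hu)
  refine ⟨(p u)⁻¹ • u, ?_, ?_⟩
  · rw [hhom _ (inv_nonneg.mpr hpu.le), inv_mul_cancel₀ hpu.ne']
  · rw [real_inner_smul_right, inv_mul_eq_div]
    refine le_antisymm (hr.1 ⟨u, hne u hu, rfl⟩) (hr.2 ?_)
    rintro _ ⟨ξ, hξ, rfl⟩
    have hξ' : 0 < ‖ξ‖⁻¹ := inv_pos.mpr (norm_pos_iff.mpr hξ)
    have hmem : ‖ξ‖⁻¹ • ξ ∈ Metric.sphere (0 : E) 1 := by
      simp [norm_smul, hξ]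
    have hle : ⟪y, ‖ξ‖⁻¹ • ξ⟫ / p (‖ξ‖⁻¹ • ξ) ≤ ⟪y, u⟫ / p u := hmax hmem
    rwa [real_inner_smul_right, hhom _ hξ'.le, mul_div_mul_left _ _ hξ'.ne'] at hle

/-- Let `p : ℝ^N → ℝ` be continuous, positively 1-homogeneous,
positive off the origin, with polar `P = p°`. If `p°` is differentiable at
`ξ* ≠ 0` with gradient `g = ∇p°(ξ*)`, then `p (∇p°(ξ*)) = 1`. -/
theorem polar_gradient_norm_one (N : ℕ) (hN : 1 ≤ N)
    (p : EuclideanSpace ℝ (Fin N) → ℝ)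
    (hcont : Continuous p)
    (hhom : ∀ t : ℝ, 0 ≤ t → ∀ ξ : EuclideanSpace ℝ (Fin N), p (t • ξ) = t * p ξ)
    (hpos : ∀ ξ : EuclideanSpace ℝ (Fin N), ξ ≠ 0 → 0 < p ξ)
    (P : EuclideanSpace ℝ (Fin N) → ℝ)
    (hP : ∀ y : EuclideanSpace ℝ (Fin N),
      IsLUB {r : ℝ | ∃ ξ : EuclideanSpace ℝ (Fin N), ξ ≠ 0 ∧ r = ⟪y, ξ⟫ / p ξ} (P y))
    (ξstar g : EuclideanSpace ℝ (Fin N)) (hξstar : ξstar ≠ 0)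
    (hderiv : HasFDerivAt P (innerSL ℝ g) ξstar) :
    p g = 1 := by
  have : Nontrivial (EuclideanSpace ℝ (Fin N)) := nontrivial_of_ne _ _ hξstar
  obtain ⟨η, hη, hηP⟩ := exists_gauge_eq_one_and_inner_eq_polar hcont hhom hpos (hP ξstar)
  have hη0 : η ≠ 0 := by
    rintro rfl
    have h := hhom 0 le_rfl 0
    rw [zero_smul, zero_mul] at h
    exact zero_ne_one (h.symm.trans hη)
  have hmin : IsLocalMin (fun y => P y - innerSL ℝ η y) ξstar := by
    refine Eventually.of_forall fun y => ?_
    have hy : ⟪y, η⟫ ≤ P y := (hP y).1 ⟨η, hη0, by rw [hη, div_one]⟩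
    simp only [innerSL_apply_apply, real_inner_comm y η, real_inner_comm ξstar η]
    linarith
  have hzero := hmin.hasFDerivAt_eq_zero (hderiv.sub (innerSL ℝ η).hasFDerivAt)
  have hgη : g = η := by
    refine ext_inner_right ℝ fun v => ?_
    simpa [sub_eq_zero] using DFunLike.congr_fun hzero v
  rw [hgη, hη]
end

section
/- Let N ≥ 1 and let Z ⊆ ℝ^{N+1}, where ℝ^{N+1} is identified with ℝ × ℝ^N and carries the Euclidean metric. If the N-dimensional Hausdorff measure of Z vanishes, H^N(Z) = 0, then for Lebesgue-almost every t ∈ ℝ the section ₜZ := { x ∈ ℝ^N : (t,x) ∈ Z } satisfies H^{N-1}(ₜZ) = 0, where H^{N-1} is the (N−1)-dimensional Hausdorff measure on ℝ^N. -/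
open MeasureTheory
open scoped MeasureTheory

/-- The identification of `ℝ × ℝ^N` with Euclidean `ℝ^{N+1}`, sending `(t, x)`
to the point with first coordinate `t` and remaining coordinates `x`. -/
noncomputable def prodToEuclidean (N : ℕ) :
    ℝ × EuclideanSpace ℝ (Fin N) → EuclideanSpace ℝ (Fin (N + 1)) :=
  fun q => (EuclideanSpace.equiv (Fin (N + 1)) ℝ).symm
    (Fin.cons q.1 (EuclideanSpace.equiv (Fin N) ℝ q.2))

open Filter Topology Set Metric
open scoped ENNReal NNReal

section Eilenberg

variable {X : Type*} [EMetricSpace X] [MeasurableSpace X] [BorelSpace X]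

/-- An `H^d`-negligible set has countable covers by sets of small diameter with small
`d`-dimensional sum. -/
theorem exists_cover_tsum_lt_of_hausdorffMeasure_eq_zero {d : ℝ} {s : Set X}
    (hs : μH[d] s = 0) {ε : ℝ≥0∞} (hε : 0 < ε) :
    ∃ u : ℕ → Set X, s ⊆ ⋃ i, u i ∧ (∀ i, ediam (u i) ≤ ε) ∧
      ∑' i, ⨆ _ : (u i).Nonempty, ediam (u i) ^ d < ε := by
  rw [Measure.hausdorffMeasure_apply] at hs
  have h := (le_iSup₂ (α := ℝ≥0∞) ε hε).trans_eq hs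
  have h' := h.trans_lt hε
  simp only [iInf_lt_iff] at h'
  obtain ⟨u, hu, hd, hlt⟩ := h'
  exact ⟨u, hu, hd, hlt⟩

/-- The negligible case of Eilenberg's inequality: almost every fibre of a real-valued Lipschitz
map on an `H^{d+1}`-negligible set is `H^d`-negligible. -/
theorem LipschitzWith.ae_hausdorffMeasure_inter_fiber_eq_zero {K : ℝ≥0} {f : X → ℝ}
    (hf : LipschitzWith K f) {d : ℝ} (hd : 0 ≤ d) {s : Set X} (hs : μH[d + 1] s = 0) :
    ∀ᵐ t : ℝ, μH[d] (s ∩ f ⁻¹' {t}) = 0 := by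
  have hε : ∀ n : ℕ, (0 : ℝ≥0∞) < (n : ℝ≥0∞)⁻¹ := fun n => by simp
  have hlim : Tendsto (fun n : ℕ => (n : ℝ≥0∞)⁻¹) atTop (𝓝 0) :=
    ENNReal.tendsto_inv_nat_nhds_zero
  choose u hcov hdiam hsum using
    fun n => exists_cover_tsum_lt_of_hausdorffMeasure_eq_zero hs (hε n)
  let g : ℕ → ℝ → ℝ≥0∞ := fun n t =>
    ∑' i, (closure (f '' u n i)).indicator (fun _ => ediam (u n i) ^ d) t
  have hg_meas : ∀ n, Measurable (g n) := fun n =>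
    Measurable.tsum fun i => measurable_const.indicator isClosed_closure.measurableSet
  have hg_int : ∀ n, ∫⁻ t, g n t ≤ K * (n : ℝ≥0∞)⁻¹ := fun n => by
    calc ∫⁻ t, g n t
        = ∑' i, ediam (u n i) ^ d * volume (closure (f '' u n i)) := by
          rw [lintegral_tsum fun i =>
            (measurable_const.indicator isClosed_closure.measurableSet).aemeasurable]
          simp_rw [lintegral_indicator_const isClosed_closure.measurableSet]
      _ ≤ ∑' i, K * ⨆ _ : (u n i).Nonempty, ediam (u n i) ^ (d + 1) := by
          refine ENNReal.tsum_le_tsum fun i => ?_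
          rcases (u n i).eq_empty_or_nonempty with h | h
          · simp [h]
          · rw [ciSup_pos h, ENNReal.rpow_add_of_nonneg _ _ hd zero_le_one, ENNReal.rpow_one,
              mul_left_comm]
            gcongr
            calc volume (closure (f '' u n i)) ≤ ediam (closure (f '' u n i)) :=
                  Real.volume_le_diam _
              _ = ediam (f '' u n i) := ediam_closure _
              _ ≤ K * ediam (u n i) := hf.ediam_image_le _
      _ ≤ K * (n : ℝ≥0∞)⁻¹ := by
          rw [ENNReal.tsum_mul_left]
          gcongr
          exact (hsum n).le
  have hliminf : ∫⁻ t, liminf (fun n => g n t) atTop = 0 := by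
    refine le_antisymm ?_ zero_le
    have hK : Tendsto (fun n : ℕ => K * (n : ℝ≥0∞)⁻¹) atTop (𝓝 0) := by
      simpa using ENNReal.Tendsto.const_mul hlim (Or.inr ENNReal.coe_ne_top)
    calc ∫⁻ t, liminf (fun n => g n t) atTop
        ≤ liminf (fun n => ∫⁻ t, g n t) atTop := lintegral_liminf_le hg_meas
      _ ≤ liminf (fun n : ℕ => K * (n : ℝ≥0∞)⁻¹) atTop :=
          liminf_le_liminf (Eventually.of_forall hg_int)
      _ = 0 := hK.liminf_eq
  filter_upwards [(lintegral_eq_zero_iff (Measurable.liminf hg_meas)).1 hliminf] with t ht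
  refine le_antisymm ?_ zero_le
  calc μH[d] (s ∩ f ⁻¹' {t})
      ≤ liminf (fun n => ∑' i : {i // (u n i ∩ f ⁻¹' {t}).Nonempty},
          ediam (u n i ∩ f ⁻¹' {t}) ^ d) atTop := by
        refine Measure.hausdorffMeasure_le_liminf_tsum d _ (fun n : ℕ => (n : ℝ≥0∞)⁻¹) hlim
          (fun n (i : {i // (u n i ∩ f ⁻¹' {t}).Nonempty}) => u n i ∩ f ⁻¹' {t})
          (Eventually.of_forall fun n i => (ediam_mono inter_subset_left).trans (hdiam n i))
          (Eventually.of_forall fun n x hx => ?_)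
        obtain ⟨i, hi⟩ := mem_iUnion.1 (hcov n hx.1)
        exact mem_iUnion.2 ⟨⟨i, x, hi, hx.2⟩, hi, hx.2⟩
    _ ≤ liminf (fun n => g n t) atTop := by
        refine liminf_le_liminf (Eventually.of_forall fun n => ?_)
        refine le_trans (ENNReal.tsum_le_tsum fun i => ?_)
          (ENNReal.tsum_comp_le_tsum_of_injective Subtype.val_injective _)
        obtain ⟨i, x, hx, rfl⟩ := i
        rw [indicator_of_mem (subset_closure (mem_image_of_mem f hx))]
        exact ENNReal.rpow_le_rpow (ediam_mono inter_subset_left) hd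
    _ = 0 := ht

end Eilenberg

theorem isometry_prodToEuclidean_mk (N : ℕ) (t : ℝ) :
    Isometry fun x : EuclideanSpace ℝ (Fin N) => prodToEuclidean N (t, x) := by
  refine Isometry.of_dist_eq fun x y => ?_
  simp [EuclideanSpace.dist_eq, Fin.sum_univ_succ, prodToEuclidean]

/-- If `Z ⊆ ℝ^{N+1} = ℝ × ℝ^N` is `H^N`-negligible, then for
Lebesgue-a.e. `t ∈ ℝ` the section `ₜZ = {x ∈ ℝ^N : (t,x) ∈ Z}` is
`H^{N-1}`-negligible. -/
theorem slicing_negligible_sets (N : ℕ) (hN : 1 ≤ N)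
    (Z : Set (EuclideanSpace ℝ (Fin (N + 1))))
    (hZ : μH[(N : ℝ)] Z = 0) :
    ∀ᵐ t : ℝ ∂(volume : Measure ℝ),
      μH[(N : ℝ) - 1] {x : EuclideanSpace ℝ (Fin N) | prodToEuclidean N (t, x) ∈ Z} = 0 := by
  have hf : LipschitzWith 1 fun z : EuclideanSpace ℝ (Fin (N + 1)) => z 0 :=
    LipschitzWith.of_dist_le_mul fun x y => by
      simpa [dist_eq_norm] using PiLp.norm_apply_le (x - y) 0
  have hd : (0 : ℝ) ≤ (N : ℝ) - 1 := sub_nonneg.2 (mod_cast hN)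
  filter_upwards [hf.ae_hausdorffMeasure_inter_fiber_eq_zero hd (by rwa [sub_add_cancel])] with t ht
  rw [← (isometry_prodToEuclidean_mk N t).hausdorffMeasure_image (Or.inl hd)]
  refine measure_mono_null ?_ ht
  rintro _ ⟨x, hx, rfl⟩
  exact ⟨hx, by simp [prodToEuclidean]⟩
end

section
/- Let (X, 𝒜, μ) be a measure space, let (h_k)_{k∈ℕ} be a sequence of μ-integrable functions h_k : X → ℝ with h_k ≥ 0 on X for all k, and let h : X → ℝ be μ-integrable. If liminf_{k→∞} h_k(x) ≥ h(x) holds for μ-almost every x ∈ X, and if ∫_X h_k dμ → ∫_X h dμ as k → ∞, then there exists a subsequence (h_{k_ℓ})_ℓ such that h_{k_ℓ}(x) → h(x) as ℓ → ∞ for μ-almost every x ∈ X. -/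
open Filter MeasureTheory

/-- If the extended-real lim inf of `u` is at least `a`, the positive parts of `a - u k` vanish
in the limit. -/
theorem tendsto_max_sub_zero_of_le_liminf {u : ℕ → ℝ} {a : ℝ}
    (ha : (a : EReal) ≤ liminf (fun k => (u k : EReal)) atTop) :
    Tendsto (fun k => max (a - u k) 0) atTop (nhds 0) := by
  refine tendsto_order.2 ⟨fun b hb => .of_forall fun k => hb.trans_le (le_max_right _ _),
    fun b hb => ?_⟩
  have hlt : ((a - b : ℝ) : EReal) < liminf (fun k => (u k : EReal)) atTop :=
    (EReal.coe_lt_coe_iff.2 (sub_lt_self a hb)).trans_le ha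
  filter_upwards [eventually_lt_of_lt_liminf hlt] with k hk
  have hk' := EReal.coe_lt_coe_iff.1 hk
  exact max_lt (by linarith) hb

/-- Nonnegative integrable functions whose lim inf dominates `g` and whose integrals converge to
that of `g` converge to `g` in `L¹`. -/
theorem tendsto_integral_abs_sub_of_le_liminf {X : Type*} [MeasurableSpace X] {μ : Measure X}
    {h : ℕ → X → ℝ} {g : X → ℝ}
    (hint : ∀ k, Integrable (h k) μ) (hnonneg : ∀ k x, 0 ≤ h k x) (hgint : Integrable g μ)
    (hliminf : ∀ᵐ x ∂μ, (g x : EReal) ≤ liminf (fun k => (h k x : EReal)) atTop)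
    (htend : Tendsto (fun k => ∫ x, h k x ∂μ) atTop (nhds (∫ x, g x ∂μ))) :
    Tendsto (fun k => ∫ x, |h k x - g x| ∂μ) atTop (nhds 0) := by
  have hpos_int (k : ℕ) : Integrable (fun x => max (g x - h k x) 0) μ :=
    (hgint.sub (hint k)).pos_part
  have hpos : Tendsto (fun k => ∫ x, max (g x - h k x) 0 ∂μ) atTop (nhds 0) := by
    have hdom := tendsto_integral_of_dominated_convergence (fun x => |g x|)
      (fun k => (hpos_int k).aestronglyMeasurable) hgint.abs
      (fun k => .of_forall fun x => by
        rw [Real.norm_of_nonneg (le_max_right _ _)]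
        exact max_le ((sub_le_self _ (hnonneg k x)).trans (le_abs_self _)) (abs_nonneg _))
      (hliminf.mono fun x hx => tendsto_max_sub_zero_of_le_liminf hx)
    simpa using hdom
  have heq (k : ℕ) : ∫ x, |h k x - g x| ∂μ =
      (∫ x, h k x ∂μ - ∫ x, g x ∂μ) + 2 * ∫ x, max (g x - h k x) 0 ∂μ := by
    rw [← integral_sub (hint k) hgint, ← integral_const_mul,
      ← integral_add (f := fun x => h k x - g x) ((hint k).sub hgint)
        ((hpos_int k).const_mul 2)]
    congr 1 with x
    rcases le_total (h k x) (g x) with hx | hx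
    · rw [abs_of_nonpos (by linarith), max_eq_left (by linarith)]
      ring
    · rw [abs_of_nonneg (by linarith), max_eq_right (by linarith)]
      ring
  simp_rw [heq]
  simpa using (htend.sub_const (∫ x, g x ∂μ)).add (hpos.const_mul 2)

/-- On an arbitrary measure space, if `(h_k)` are nonnegative
integrable functions, `g` is integrable, `liminf_k h_k ≥ g` holds `μ`-a.e.
(with the lim inf taken in the extended reals), and `∫ h_k dμ → ∫ g dμ`, then
some subsequence of `(h_k)` converges to `g` pointwise `μ`-a.e. -/
theorem ae_convergent_subsequence {X : Type*} [MeasurableSpace X] (μ : Measure X)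
    (h : ℕ → X → ℝ) (g : X → ℝ)
    (hint : ∀ k, Integrable (h k) μ)
    (hnonneg : ∀ k, ∀ x, 0 ≤ h k x)
    (hgint : Integrable g μ)
    (hliminf : ∀ᵐ x ∂μ,
      (g x : EReal) ≤ Filter.liminf (fun k => ((h k x : ℝ) : EReal)) Filter.atTop)
    (htend : Tendsto (fun k => ∫ x, h k x ∂μ) atTop (nhds (∫ x, g x ∂μ))) :
    ∃ φ : ℕ → ℕ, StrictMono φ ∧
      ∀ᵐ x ∂μ, Tendsto (fun ℓ => h (φ ℓ) x) atTop (nhds (g x)) := by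
  refine (tendstoInMeasure_of_tendsto_eLpNorm one_ne_zero
    (fun k => (hint k).aestronglyMeasurable) hgint.aestronglyMeasurable ?_).exists_seq_tendsto_ae
  have heq (k : ℕ) : eLpNorm (h k - g) 1 μ = ENNReal.ofReal (∫ x, |h k x - g x| ∂μ) := by
    rw [eLpNorm_one_eq_lintegral_enorm, ← ofReal_integral_norm_eq_lintegral_enorm
      ((hint k).sub hgint)]
    rfl
  simp_rw [heq]
  simpa using ENNReal.tendsto_ofReal
    (tendsto_integral_abs_sub_of_le_liminf hint hnonneg hgint hliminf htend)
end

section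
/- Let N ≥ 1 and let f : ℝ^N → ℝ be convex with α·|ξ| ≤ f(ξ) ≤ β·(|ξ|+1) for all ξ (constants 0 < α ≤ β), with recession function f∞ and perspective function f̃. If f(ξ) ≥ f∞(ξ) holds for all ξ ∈ ℝ^N, then the function p : ℝ × ℝ^N → ℝ defined by p(ξ₀, ξ) := f̃(|ξ₀|, ξ) is convex on ℝ × ℝ^N and positively 1-homogeneous, i.e. p(s·ξ₀, s·ξ) = s·p(ξ₀, ξ) for all s ≥ 0. -/
open Filter

/-- The perspective (homogenized) function of `f`, with recession function `finf`:
`pers f finf t ξ = t * f (ξ / t)` for `t > 0` and `pers f finf 0 ξ = finf ξ`. -/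
noncomputable def pers {N : ℕ} (f finf : EuclideanSpace ℝ (Fin N) → ℝ)
    (t : ℝ) (ξ : EuclideanSpace ℝ (Fin N)) : ℝ :=
  if 0 < t then t * f (t⁻¹ • ξ) else finf ξ

section Recession

variable {N : ℕ} {f finf : EuclideanSpace ℝ (Fin N) → ℝ}

theorem pers_zero (ξ : EuclideanSpace ℝ (Fin N)) : pers f finf 0 ξ = finf ξ := by
  simp [pers]

theorem pers_of_pos {t : ℝ} (ht : 0 < t) (ξ : EuclideanSpace ℝ (Fin N)) :
    pers f finf t ξ = t * f (t⁻¹ • ξ) := by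
  simp [pers, ht]

theorem recession_smul
    (hfinf : ∀ ξ : EuclideanSpace ℝ (Fin N),
      Tendsto (fun s : ℝ => f (s • ξ) / s) atTop (nhds (finf ξ)))
    {s : ℝ} (hs : 0 ≤ s) (ξ : EuclideanSpace ℝ (Fin N)) : finf (s • ξ) = s * finf ξ := by
  rcases hs.eq_or_lt with rfl | hs
  · have h : Tendsto (fun s : ℝ => f (s • (0 : EuclideanSpace ℝ (Fin N))) / s) atTop
        (nhds 0) := by
      simpa using tendsto_const_nhds.div_atTop (tendsto_id (α := ℝ) (x := atTop))
    simpa using tendsto_nhds_unique (hfinf 0) h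
  · have h := ((hfinf ξ).comp (tendsto_id.atTop_mul_const hs)).const_mul s
    refine tendsto_nhds_unique (hfinf (s • ξ)) (h.congr fun t => ?_)
    simp only [Function.comp_apply, id_eq, mul_smul]
    field_simp

theorem ConvexOn.add_le_add_recession (hconv : ConvexOn ℝ Set.univ f)
    (hfinf : ∀ ξ : EuclideanSpace ℝ (Fin N),
      Tendsto (fun s : ℝ => f (s • ξ) / s) atTop (nhds (finf ξ)))
    (x y : EuclideanSpace ℝ (Fin N)) : f (x + y) ≤ f x + finf y := by
  have hcont : Continuous f := by
    rw [← continuousOn_univ]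
    exact hconv.continuousOn isOpen_univ
  have hc : Tendsto (fun s : ℝ => 1 - s⁻¹) atTop (nhds 1) := by
    simpa using tendsto_inv_atTop_zero.const_sub (1 : ℝ)
  have hl : Tendsto (fun s : ℝ => f ((1 - s⁻¹) • x + y)) atTop (nhds (f (x + y))) := by
    have h := (hc.smul_const x).add_const y
    rw [one_smul] at h
    exact (hcont.tendsto _).comp h
  have hr : Tendsto (fun s : ℝ => (1 - s⁻¹) * f x + f (s • y) / s) atTop
      (nhds (f x + finf y)) := by
    simpa using (hc.mul_const (f x)).add (hfinf y)
  refine le_of_tendsto_of_tendsto hl hr ?_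
  filter_upwards [eventually_ge_atTop 1] with s hs
  have hs0 : 0 < s := by linarith
  have h := hconv.2 (Set.mem_univ x) (Set.mem_univ (s • y))
    (sub_nonneg.2 (inv_le_one_of_one_le₀ hs)) (inv_nonneg.2 hs0.le) (by ring)
  rw [inv_smul_smul₀ hs0.ne', smul_eq_mul, smul_eq_mul] at h
  rwa [div_eq_inv_mul]

theorem ConvexOn.recession_add_le (hconv : ConvexOn ℝ Set.univ f)
    (hfinf : ∀ ξ : EuclideanSpace ℝ (Fin N),
      Tendsto (fun s : ℝ => f (s • ξ) / s) atTop (nhds (finf ξ)))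
    (x y : EuclideanSpace ℝ (Fin N)) : finf (x + y) ≤ finf x + finf y := by
  refine le_of_tendsto_of_tendsto (hfinf (x + y)) ((hfinf x).add_const (finf y)) ?_
  filter_upwards [eventually_gt_atTop 0] with s hs
  have h := hconv.add_le_add_recession hfinf (s • x) (s • y)
  rw [recession_smul hfinf hs.le, ← smul_add] at h
  rw [div_add' _ _ _ hs.ne']
  gcongr
  linarith

theorem pers_smul
    (hfinf : ∀ ξ : EuclideanSpace ℝ (Fin N),
      Tendsto (fun s : ℝ => f (s • ξ) / s) atTop (nhds (finf ξ)))
    {s t : ℝ} (hs : 0 ≤ s) (ht : 0 ≤ t) (ξ : EuclideanSpace ℝ (Fin N)) :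
    pers f finf (s * t) (s • ξ) = s * pers f finf t ξ := by
  rcases ht.eq_or_lt with rfl | ht
  · rw [mul_zero, pers_zero, pers_zero, recession_smul hfinf hs]
  rcases hs.eq_or_lt with rfl | hs
  · rw [zero_mul, pers_zero, recession_smul hfinf le_rfl, zero_mul, zero_mul]
  rw [pers_of_pos (mul_pos hs ht), pers_of_pos ht, smul_smul, mul_assoc]
  congr 4
  field_simp

theorem ConvexOn.pers_add_le (hconv : ConvexOn ℝ Set.univ f)
    (hfinf : ∀ ξ : EuclideanSpace ℝ (Fin N),
      Tendsto (fun s : ℝ => f (s • ξ) / s) atTop (nhds (finf ξ)))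
    {t u : ℝ} (ht : 0 ≤ t) (hu : 0 ≤ u) (x y : EuclideanSpace ℝ (Fin N)) :
    pers f finf (t + u) (x + y) ≤ pers f finf t x + pers f finf u y := by
  have key : ∀ {t : ℝ}, 0 < t → ∀ x y : EuclideanSpace ℝ (Fin N),
      pers f finf t (x + y) ≤ pers f finf t x + finf y := by
    intro t ht x y
    have h := hconv.add_le_add_recession hfinf (t⁻¹ • x) (t⁻¹ • y)
    rw [recession_smul hfinf (inv_nonneg.2 ht.le), ← smul_add] at h
    rw [pers_of_pos ht, pers_of_pos ht]
    calc t * f (t⁻¹ • (x + y)) ≤ t * (f (t⁻¹ • x) + t⁻¹ * finf y) := by gcongr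
      _ = t * f (t⁻¹ • x) + finf y := by field_simp
  rcases ht.eq_or_lt with rfl | ht <;> rcases hu.eq_or_lt with rfl | hu
  · simpa only [add_zero, pers_zero] using hconv.recession_add_le hfinf x y
  · rw [zero_add, pers_zero, add_comm x, add_comm (finf x)]
    exact key hu y x
  · simpa only [add_zero, pers_zero] using key ht x y
  · have htu : 0 < t + u := add_pos ht hu
    have h := hconv.2 (Set.mem_univ (t⁻¹ • x)) (Set.mem_univ (u⁻¹ • y))
      (div_nonneg ht.le htu.le) (div_nonneg hu.le htu.le) (by field_simp)
    rw [smul_smul, smul_smul, show t / (t + u) * t⁻¹ = (t + u)⁻¹ by field_simp,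
      show u / (t + u) * u⁻¹ = (t + u)⁻¹ by field_simp, ← smul_add, smul_eq_mul,
      smul_eq_mul] at h
    rw [pers_of_pos htu, pers_of_pos ht, pers_of_pos hu]
    calc (t + u) * f ((t + u)⁻¹ • (x + y))
        ≤ (t + u) * (t / (t + u) * f (t⁻¹ • x) + u / (t + u) * f (u⁻¹ • y)) := by gcongr
      _ = t * f (t⁻¹ • x) + u * f (u⁻¹ • y) := by field_simp

theorem ConvexOn.pers_mono (hconv : ConvexOn ℝ Set.univ f)
    (hfinf : ∀ ξ : EuclideanSpace ℝ (Fin N),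
      Tendsto (fun s : ℝ => f (s • ξ) / s) atTop (nhds (finf ξ)))
    (hge : ∀ ξ : EuclideanSpace ℝ (Fin N), finf ξ ≤ f ξ)
    {t u : ℝ} (ht : 0 ≤ t) (htu : t ≤ u) (ξ : EuclideanSpace ℝ (Fin N)) :
    pers f finf t ξ ≤ pers f finf u ξ := by
  rcases (ht.trans htu).eq_or_lt with rfl | hu
  · rw [le_antisymm htu ht]
  have h0 : finf ξ ≤ pers f finf u ξ := by
    rw [pers_of_pos hu]
    calc finf ξ = u * finf (u⁻¹ • ξ) := by
          rw [← recession_smul hfinf hu.le, smul_inv_smul₀ hu.ne']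
      _ ≤ u * f (u⁻¹ • ξ) := mul_le_mul_of_nonneg_left (hge _) hu.le
  have hc0 : 0 ≤ t / u := div_nonneg ht hu.le
  have hc1 : 0 ≤ 1 - t / u := sub_nonneg.2 ((div_le_one hu).2 htu)
  have h := hconv.pers_add_le hfinf (mul_nonneg hc0 hu.le) (le_refl 0)
    ((t / u) • ξ) ((1 - t / u) • ξ)
  rw [← add_smul, add_sub_cancel, one_smul, add_zero, pers_smul hfinf hc0 hu.le, pers_zero,
    recession_smul hfinf hc1, div_mul_cancel₀ _ hu.ne'] at h
  calc pers f finf t ξ ≤ t / u * pers f finf u ξ + (1 - t / u) * finf ξ := h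
    _ ≤ t / u * pers f finf u ξ + (1 - t / u) * pers f finf u ξ := by gcongr
    _ = pers f finf u ξ := by ring

end Recession

/-- For `f : ℝ^N → ℝ` convex with linear growth, recession
function `f∞`, and perspective `f̃`: if `f ≥ f∞` everywhere, then
`p (ξ₀, ξ) := f̃(|ξ₀|, ξ)` is convex on `ℝ × ℝ^N` and positively
1-homogeneous. -/
theorem homogenized_integrand_convex (N : ℕ) (hN : 1 ≤ N)
    (f finf : EuclideanSpace ℝ (Fin N) → ℝ) (α β : ℝ)
    (hα : 0 < α) (hαβ : α ≤ β)
    (hconv : ConvexOn ℝ Set.univ f)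
    (hgrowth : ∀ ξ : EuclideanSpace ℝ (Fin N), α * ‖ξ‖ ≤ f ξ ∧ f ξ ≤ β * (‖ξ‖ + 1))
    (hfinf : ∀ ξ : EuclideanSpace ℝ (Fin N),
      Tendsto (fun s : ℝ => f (s • ξ) / s) atTop (nhds (finf ξ)))
    (hge : ∀ ξ : EuclideanSpace ℝ (Fin N), finf ξ ≤ f ξ) :
    ConvexOn ℝ Set.univ
      (fun q : ℝ × EuclideanSpace ℝ (Fin N) => pers f finf |q.1| q.2) ∧
    ∀ s : ℝ, 0 ≤ s → ∀ ξ₀ : ℝ, ∀ ξ : EuclideanSpace ℝ (Fin N),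
      pers f finf |s * ξ₀| (s • ξ) = s * pers f finf |ξ₀| ξ := by
  refine ⟨⟨convex_univ, ?_⟩, ?_⟩
  · rintro ⟨x₀, x⟩ - ⟨y₀, y⟩ - a b ha hb -
    simp only [Prod.fst_add, Prod.snd_add, Prod.smul_fst, Prod.smul_snd, smul_eq_mul]
    have habs : |a * x₀ + b * y₀| ≤ a * |x₀| + b * |y₀| := by
      refine (abs_add_le _ _).trans_eq ?_
      rw [abs_mul, abs_mul, abs_of_nonneg ha, abs_of_nonneg hb]
    calc pers f finf |a * x₀ + b * y₀| (a • x + b • y)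
        ≤ pers f finf (a * |x₀| + b * |y₀|) (a • x + b • y) :=
          hconv.pers_mono hfinf hge (abs_nonneg _) habs _
      _ ≤ pers f finf (a * |x₀|) (a • x) + pers f finf (b * |y₀|) (b • y) :=
          hconv.pers_add_le hfinf (by positivity) (by positivity) _ _
      _ = a * pers f finf |x₀| x + b * pers f finf |y₀| y := by
          rw [pers_smul hfinf ha (abs_nonneg _), pers_smul hfinf hb (abs_nonneg _)]
  · intro s hs ξ₀ ξ
    rw [abs_mul, abs_of_nonneg hs, pers_smul hfinf hs (abs_nonneg _)]
end

section
/- Let N ≥ 1 and let f : ℝ^N → ℝ be convex with α·|ξ| ≤ f(ξ) ≤ β·(|ξ|+1) for all ξ (constants 0 < α ≤ β), with perspective function f̃. Then for every fixed ξ ∈ ℝ^N, the map t ↦ f̃(t,ξ) − f̃(t,0) is nonincreasing on [0,∞): for all 0 ≤ t₁ ≤ t₂ one has f̃(t₂,ξ) − f̃(t₂,0) ≤ f̃(t₁,ξ) − f̃(t₁,0). -/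
open Filter

/-- For a convex `f`, the map `t ↦ t * f (t⁻¹ • x) - t * f 0` is nonincreasing on `(0, ∞)`. -/
theorem ConvexOn.mul_inv_smul_sub_le {E : Type*} [AddCommGroup E] [Module ℝ E] {f : E → ℝ}
    (hf : ConvexOn ℝ Set.univ f) (x : E) {a b : ℝ} (ha : 0 < a) (hab : a ≤ b) :
    b * f (b⁻¹ • x) - b * f 0 ≤ a * f (a⁻¹ • x) - a * f 0 := by
  have hb : 0 < b := ha.trans_le hab
  have h := hf.2 (Set.mem_univ (a⁻¹ • x)) (Set.mem_univ (0 : E)) (div_nonneg ha.le hb.le)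
    (sub_nonneg.2 ((div_le_one hb).2 hab)) (add_sub_cancel _ _)
  have hx : (a / b) • a⁻¹ • x + (1 - a / b) • (0 : E) = b⁻¹ • x := by
    rw [smul_zero, add_zero, smul_smul]
    congr 1
    field_simp
  rw [hx, smul_eq_mul, smul_eq_mul] at h
  have hmul := mul_le_mul_of_nonneg_left h hb.le
  have hexp : b * (a / b * f (a⁻¹ • x) + (1 - a / b) * f 0)
      = a * f (a⁻¹ • x) + (b - a) * f 0 := by
    field_simp
  linarith

/-- For `f : ℝ^N → ℝ` convex with linear growth and
perspective `f̃`: for every fixed `ξ`, the map `t ↦ f̃(t,ξ) − f̃(t,0)` is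
nonincreasing on `[0,∞)`. -/
theorem perspective_difference_antitone (N : ℕ) (hN : 1 ≤ N)
    (f finf : EuclideanSpace ℝ (Fin N) → ℝ) (α β : ℝ)
    (hα : 0 < α) (hαβ : α ≤ β)
    (hconv : ConvexOn ℝ Set.univ f)
    (hgrowth : ∀ ξ : EuclideanSpace ℝ (Fin N), α * ‖ξ‖ ≤ f ξ ∧ f ξ ≤ β * (‖ξ‖ + 1))
    (hfinf : ∀ ξ : EuclideanSpace ℝ (Fin N),
      Tendsto (fun s : ℝ => f (s • ξ) / s) atTop (nhds (finf ξ))) :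
    ∀ ξ : EuclideanSpace ℝ (Fin N), ∀ t₁ t₂ : ℝ, 0 ≤ t₁ → t₁ ≤ t₂ →
      pers f finf t₂ ξ - pers f finf t₂ 0 ≤ pers f finf t₁ ξ - pers f finf t₁ 0 := by
  intro ξ t₁ t₂ h₁ h₁₂
  rcases h₁.eq_or_lt with rfl | h₁
  · have h_zero : Tendsto (fun s : ℝ => f 0 / s) atTop (nhds 0) :=
      tendsto_const_nhds.div_atTop tendsto_id
    have h_finf_zero : finf 0 = 0 :=
      tendsto_nhds_unique (by simpa using hfinf 0) h_zero
    rcases h₁₂.eq_or_lt with rfl | h₂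
    · exact le_rfl
    · simp only [pers, h₂, if_true, lt_irrefl, if_false, smul_zero, h_finf_zero]
      refine ge_of_tendsto ((hfinf ξ).sub h_zero) ?_
      filter_upwards [eventually_ge_atTop t₂⁻¹] with s hs
      have hs_pos : 0 < s := (inv_pos.2 h₂).trans_le hs
      have h := hconv.mul_inv_smul_sub_le ξ (inv_pos.2 hs_pos) (inv_le_of_inv_le₀ h₂ hs)
      simpa only [inv_inv, inv_mul_eq_div] using h
  · simp only [pers, h₁, h₁.trans_le h₁₂, if_true, smul_zero]
    exact hconv.mul_inv_smul_sub_le ξ h₁ h₁₂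
end

section
/- Let q : ℝ² → ℝ be positively 1-homogeneous (q(t·x) = t·q(x) for t ≥ 0), convex, and satisfy q(x) > 0 for all x ≠ 0. Let A ⊆ ℝ² be Lebesgue measurable and r ≥ 0 be such that the Lebesgue measures satisfy |A| = |{x : q(x) < r}| < ∞. Then ∫_A 1/q(x) dx ≤ ∫_{{q < r}} 1/q(x) dx (Lebesgue integrals, which are finite), and equality holds if and only if the symmetric difference A △ {q < r} is Lebesgue-null. -/
open MeasureTheory

/-- Bathtub principle: among sets of a given finite measure, the integral of `f` is maximised
by a superlevel set of `f`. -/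
theorem setLIntegral_le_of_measure_eq_of_superlevel {α : Type*} [MeasurableSpace α]
    {μ : Measure α} {f : α → ENNReal} {A B : Set α} (hA : MeasurableSet A)
    (hB : MeasurableSet B) (hAB : μ A = μ B) (hfin : μ A ≠ ⊤) {c : ENNReal}
    (hle : ∀ x ∉ B, f x ≤ c) (hge : ∀ᵐ x ∂μ, x ∈ B → c ≤ f x) :
    ∫⁻ x in A, f x ∂μ ≤ ∫⁻ x in B, f x ∂μ := by
  have hdiff : μ (A \ B) = μ (B \ A) := measure_sdiff_symm hA.nullMeasurableSet
    hB.nullMeasurableSet hAB (measure_ne_top_of_subset Set.inter_subset_left hfin)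
  rw [← lintegral_inter_add_sdiff f A hB, ← lintegral_inter_add_sdiff f B hA, Set.inter_comm B A]
  refine add_le_add_right ?_ _
  calc ∫⁻ x in A \ B, f x ∂μ ≤ ∫⁻ _ in A \ B, c ∂μ :=
        setLIntegral_mono' (hA.diff hB) fun x hx => hle x hx.2
    _ = ∫⁻ _ in B \ A, c ∂μ := by rw [setLIntegral_const, setLIntegral_const, hdiff]
    _ ≤ ∫⁻ x in B \ A, f x ∂μ := setLIntegral_mono_ae' (hB.diff hA) <| by
        filter_upwards [hge] with x hx hxB using hx hxB.1

/-- Equality case of the bathtub principle for strict superlevel sets. -/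
theorem setLIntegral_eq_iff_of_measure_eq_of_superlevel {α : Type*} [MeasurableSpace α]
    {μ : Measure α} {f : α → ENNReal} (hf : Measurable f) {A B : Set α} (hA : MeasurableSet A)
    (hB : MeasurableSet B) (hAB : μ A = μ B) (hfin : μ A ≠ ⊤) {c : ENNReal}
    (hle : ∀ x ∉ B, f x ≤ c) (hgt : ∀ᵐ x ∂μ, x ∈ B → c < f x)
    (hint : ∫⁻ x in B, f x ∂μ ≠ ⊤) :
    ∫⁻ x in A, f x ∂μ = ∫⁻ x in B, f x ∂μ ↔ μ (symmDiff A B) = 0 := by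
  refine ⟨fun h => ?_, fun h => setLIntegral_congr (measure_symmDiff_eq_zero_iff.1 h)⟩
  have hdiff : μ (A \ B) = μ (B \ A) := measure_sdiff_symm hA.nullMeasurableSet
    hB.nullMeasurableSet hAB (measure_ne_top_of_subset Set.inter_subset_left hfin)
  suffices hBA : μ (B \ A) = 0 from measure_symmDiff_eq_zero_iff.2 (ae_eq_set.2 ⟨hdiff ▸ hBA, hBA⟩)
  by_contra hBA
  refine h.not_lt ?_
  have hconst : ∫⁻ _ in A \ B, c ∂μ = ∫⁻ _ in B \ A, c ∂μ := by
    rw [setLIntegral_const, setLIntegral_const, hdiff]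
  have hdiff_fin : ∫⁻ x in B \ A, f x ∂μ ≠ ⊤ :=
    ne_top_of_le_ne_top hint (lintegral_mono_set Set.sdiff_subset)
  have hgt' : ∀ᵐ x ∂μ, x ∈ B \ A → c < f x := by
    filter_upwards [hgt] with x hx hxB using hx hxB.1
  have hconst_fin : ∫⁻ _ in B \ A, c ∂μ ≠ ⊤ :=
    ne_top_of_le_ne_top hdiff_fin (setLIntegral_mono_ae' (hB.diff hA) (hgt'.mono
      fun _ hx hxB => (hx hxB).le))
  rw [← lintegral_inter_add_sdiff f A hB, ← lintegral_inter_add_sdiff f B hA, Set.inter_comm B A]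
  refine ENNReal.add_lt_add_left
    (ne_top_of_le_ne_top hint (lintegral_mono_set Set.inter_subset_right)) ?_
  calc ∫⁻ x in A \ B, f x ∂μ ≤ ∫⁻ _ in A \ B, c ∂μ :=
        setLIntegral_mono' (hA.diff hB) fun x hx => hle x hx.2
    _ = ∫⁻ _ in B \ A, c ∂μ := hconst
    _ < ∫⁻ x in B \ A, f x ∂μ := setLIntegral_strict_mono (hB.diff hA) hBA hf hconst_fin hgt'

/-- A positively homogeneous continuous function that is positive off the origin dominates a
positive multiple of the norm. -/
theorem exists_pos_mul_norm_le_of_homogeneous {E : Type*} [NormedAddCommGroup E]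
    [NormedSpace ℝ E] [FiniteDimensional ℝ E] {q : E → ℝ}
    (hhom : ∀ t : ℝ, 0 ≤ t → ∀ x, q (t • x) = t * q x) (hcont : Continuous q)
    (hpos : ∀ x, x ≠ 0 → 0 < q x) : ∃ c > 0, ∀ x, c * ‖x‖ ≤ q x := by
  have hzero : q 0 = 0 := by simpa using hhom 0 le_rfl 0
  obtain hE | hE := subsingleton_or_nontrivial E
  · exact ⟨1, one_pos, fun x => by simp [Subsingleton.elim x 0, hzero]⟩
  obtain ⟨u, hu, hmin⟩ := (isCompact_sphere (0 : E) 1).exists_isMinOn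
    (NormedSpace.sphere_nonempty.2 zero_le_one) hcont.continuousOn
  refine ⟨q u, hpos u (ne_zero_of_mem_unit_sphere ⟨u, hu⟩), fun x => ?_⟩
  obtain rfl | hx := eq_or_ne x 0
  · simp [hzero]
  have hxn : 0 < ‖x‖ := norm_pos_iff.2 hx
  have hmem : ‖x‖⁻¹ • x ∈ Metric.sphere (0 : E) 1 := by simp [norm_smul, hxn.ne']
  have h : q u ≤ ‖x‖⁻¹ * q x := by
    simpa only [hhom _ (inv_nonneg.2 hxn.le)] using isMinOn_iff.1 hmin _ hmem
  rwa [← div_eq_inv_mul, le_div_iff₀ hxn] at h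

/-- Let `q : ℝ² → ℝ` be positively 1-homogeneous, convex, and
positive off the origin. If `A ⊆ ℝ²` is measurable and `r ≥ 0` is such that
`|A| = |{q < r}| < ∞`, then `∫_A 1/q ≤ ∫_{{q<r}} 1/q` (both Lebesgue integrals
being finite), with equality iff `A △ {q < r}` is Lebesgue-null. -/
theorem integral_reciprocal_anisotropy_le (q : EuclideanSpace ℝ (Fin 2) → ℝ)
    (hhom : ∀ t : ℝ, 0 ≤ t → ∀ x : EuclideanSpace ℝ (Fin 2), q (t • x) = t * q x)
    (hconv : ConvexOn ℝ Set.univ q)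
    (hpos : ∀ x : EuclideanSpace ℝ (Fin 2), x ≠ 0 → 0 < q x)
    (A : Set (EuclideanSpace ℝ (Fin 2))) (hA : MeasurableSet A)
    (r : ℝ) (hr : 0 ≤ r)
    (hvol : volume A = volume {x : EuclideanSpace ℝ (Fin 2) | q x < r})
    (hfin : volume A < ⊤) :
    (∫⁻ x in {x : EuclideanSpace ℝ (Fin 2) | q x < r}, ENNReal.ofReal (q x)⁻¹) < ⊤ ∧
    (∫⁻ x in A, ENNReal.ofReal (q x)⁻¹)
      ≤ ∫⁻ x in {x : EuclideanSpace ℝ (Fin 2) | q x < r}, ENNReal.ofReal (q x)⁻¹ ∧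
    ((∫⁻ x in A, ENNReal.ofReal (q x)⁻¹)
        = ∫⁻ x in {x : EuclideanSpace ℝ (Fin 2) | q x < r}, ENNReal.ofReal (q x)⁻¹ ↔
      volume (symmDiff A {x : EuclideanSpace ℝ (Fin 2) | q x < r}) = 0) := by
  set B := {x : EuclideanSpace ℝ (Fin 2) | q x < r} with hBdef
  have hcont : Continuous q := continuousOn_univ.1 (hconv.continuousOn isOpen_univ)
  have hzero : q 0 = 0 := by simpa using hhom 0 le_rfl 0
  have hnonneg : ∀ x, 0 ≤ q x := fun x => by
    obtain rfl | hx := eq_or_ne x 0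
    exacts [hzero.ge, (hpos x hx).le]
  obtain ⟨c, hc, hcq⟩ := exists_pos_mul_norm_le_of_homogeneous hhom hcont hpos
  have hB : MeasurableSet B := measurableSet_lt hcont.measurable measurable_const
  have hmeas : Measurable fun x => ENNReal.ofReal (q x)⁻¹ :=
    hcont.measurable.inv.ennreal_ofReal
  have hloc : LocallyIntegrable (fun x => (q x)⁻¹) volume := by
    refine locallyIntegrable_of_norm_le_rpow (C := c⁻¹) (α := 1) (by simp) (by simp)
      (ae_of_all _ fun x => ?_) hcont.measurable.inv.aestronglyMeasurable
    rw [Real.norm_of_nonneg (inv_nonneg.2 (hnonneg x)), Real.rpow_neg_one, ← mul_inv]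
    obtain rfl | hx := eq_or_ne x 0
    · simp [hzero]
    · exact inv_anti₀ (mul_pos hc (norm_pos_iff.2 hx)) (hcq x)
  have hsub : B ⊆ Metric.closedBall 0 (r / c) := fun x hx => by
    rw [mem_closedBall_zero_iff, le_div_iff₀' hc]
    exact (hcq x).trans (le_of_lt hx)
  have hint : ∫⁻ x in B, ENNReal.ofReal (q x)⁻¹ < ⊤ :=
    ((hloc.integrableOn_isCompact (isCompact_closedBall 0 (r / c))).mono_set hsub).lintegral_lt_top
  refine ⟨hint, ?_⟩
  obtain rfl | hr := hr.eq_or_lt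
  · have hBe : B = ∅ := Set.eq_empty_of_forall_notMem fun x hx => (hnonneg x).not_gt hx
    have hA0 : volume A = 0 := by rw [hvol, hBe, measure_empty]
    simp [hBe, hA0, setLIntegral_measure_zero]
  have hle : ∀ x ∉ B, ENNReal.ofReal (q x)⁻¹ ≤ ENNReal.ofReal r⁻¹ := fun x hx =>
    ENNReal.ofReal_le_ofReal (inv_anti₀ hr (not_lt.1 hx))
  have hgt : ∀ᵐ x, x ∈ B → ENNReal.ofReal r⁻¹ < ENNReal.ofReal (q x)⁻¹ := by
    filter_upwards [Measure.ae_ne volume 0] with x hx hxB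
    exact (ENNReal.ofReal_lt_ofReal_iff (inv_pos.2 (hpos x hx))).2 (inv_strictAnti₀ (hpos x hx) hxB)
  exact ⟨setLIntegral_le_of_measure_eq_of_superlevel hA hB hvol hfin.ne hle
      (hgt.mono fun _ hx hxB => (hx hxB).le),
    setLIntegral_eq_iff_of_measure_eq_of_superlevel hmeas hA hB hvol hfin.ne hle hgt hint.ne⟩
end
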